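/- Define Φ_ν(q) = ∑_{n=1}^∞ n^ν q^n/(1−q^n) for |q| < 1, Q(q) = 1 + 240·Φ₃(q), and R(q) = 1 − 504·Φ₅(q). Then Φ₁₅(q) = (−3617 + 1617·Q(q)⁴ + 2000·Q(q)·R(q)²)/16320. -/

import Mathlib

/-- Lambert-type Eisenstein series Φ_ν(q) = ∑_{n=1}^∞ n^ν q^n/(1−q^n). -/
noncomputable def Phi (ν : ℕ) (q : ℂ) : ℂ :=
  ∑' n : ℕ, ((n : ℂ) + 1) ^ ν * q ^ (n + 1) / (1 - q ^ (n + 1))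

open UpperHalfPlane ModularForm EisensteinSeries MatrixGroups Complex

open scoped Real

lemma bernoulli_four_val : bernoulli 4 = -1 / 30 := by decide +kernel

lemma bernoulli_six_val : bernoulli 6 = 1 / 42 := by decide +kernel

lemma bernoulli_sixteen_val : bernoulli 16 = -3617 / 510 := by decide +kernel

/-- The weight 16 form `3617 E₁₆ - 1617 E₄⁴ - 2000 E₄ E₆²`. -/
noncomputable def weight16Form : ModularForm 𝒮ℒ ((16 : ℕ) : ℤ) :=
  ((3617 : ℂ) • E (by norm_num : 3 ≤ 16)
    - (1617 : ℂ) • ModularForm.mcast (by norm_num) (E₄.pow 4))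
    - (2000 : ℂ) • ModularForm.mcast (by norm_num) (E₄.mul (E₆.pow 2))

lemma weight16Form_apply (z : ℍ) :
    weight16Form z = 3617 * E (by norm_num : 3 ≤ 16) z - 1617 * E₄ z ^ 4
      - 2000 * (E₄ z * E₆ z ^ 2) := by
  have h1 : (E₄.pow 4) z = E₄ z ^ 4 := congrFun (coe_pow E₄ 4) z
  have h2 : (E₄.mul (E₆.pow 2)) z = E₄ z * E₆ z ^ 2 := by
    rw [coe_mul, Pi.mul_apply, coe_pow, Pi.pow_apply]
  simp [weight16Form, coe_mcast, h1, h2]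

lemma weight16Form_qExpansion :
    qExpansion 1 weight16Form =
      (3617 : ℂ) • qExpansion 1 (E (by norm_num : 3 ≤ 16))
      - (1617 : ℂ) • (qExpansion 1 E₄) ^ 4
      - (2000 : ℂ) • (qExpansion 1 E₄ * (qExpansion 1 E₆) ^ 2) := by
  have h1 := one_mem_strictPeriods_SL
  simp only [weight16Form]
  rw [FunLike.coe_sub, ModularForm.qExpansion_sub one_pos h1,
    FunLike.coe_sub, ModularForm.qExpansion_sub one_pos h1,
    FunLike.coe_smul, FunLike.coe_smul, FunLike.coe_smul,
    ModularForm.qExpansion_smul one_pos h1, ModularForm.qExpansion_smul one_pos h1,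
    ModularForm.qExpansion_smul one_pos h1, ModularForm.qExpansion_mcast,
    ModularForm.qExpansion_mcast, ModularForm.qExpansion_pow one_pos h1,
    ModularForm.qExpansion_mul one_pos h1, ModularForm.qExpansion_pow one_pos h1]

lemma E16_coeff_one :
    (qExpansion 1 (E (by norm_num : 3 ≤ 16))).coeff 1 = 16320 / 3617 := by
  norm_num [E_qExpansion_coeff _ (⟨8, rfl⟩ : Even 16), bernoulli_sixteen_val]

lemma coeff_one_mul_aux (A B : PowerSeries ℂ) :
    (A * B).coeff 1 = A.coeff 1 * B.coeff 0 + A.coeff 0 * B.coeff 1 := by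
  simp [PowerSeries.coeff_mul, Finset.Nat.antidiagonal_succ]
  ring

lemma weight16Form_eq_zero : weight16Form = 0 := by
  apply sturm_bound_levelOne_nat
  refine lt_of_lt_of_le (b := ((2 : ℕ) : ℕ∞)) (by norm_num) ?_
  apply PowerSeries.nat_le_order
  intro i hi
  have a0 := E_qExpansion_coeff_zero (by norm_num : 3 ≤ 4) ⟨2, rfl⟩
  have b0 := E_qExpansion_coeff_zero (by norm_num : 3 ≤ 6) ⟨3, rfl⟩
  have c0 := E_qExpansion_coeff_zero (by norm_num : 3 ≤ 16) ⟨8, rfl⟩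
  have a1 := E₄_qExpansion_coeff_one
  have b1 := E₆_qExpansion_coeff_one
  have c1 := E16_coeff_one
  rw [weight16Form_qExpansion]
  generalize qExpansion 1 (E (by norm_num : 3 ≤ 16)) = C at *
  generalize qExpansion 1 E₄ = A at *
  generalize qExpansion 1 E₆ = B at *
  interval_cases i
  · simp only [PowerSeries.coeff_zero_eq_constantCoeff] at *
    simp [a0, b0, c0]
    norm_num
  · simp only [map_sub, PowerSeries.coeff_smul, pow_succ, pow_zero, one_mul,
      coeff_one_mul_aux]
    simp only [PowerSeries.coeff_zero_eq_constantCoeff] at *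
    simp [a0, b0, c0, a1, b1, c1]
    norm_num

lemma Phi_eq_sigma (ν : ℕ) {q : ℂ} (hq : ‖q‖ < 1) :
    Phi ν q = ∑' n : ℕ+, (ArithmeticFunction.sigma ν n : ℂ) * q ^ (n : ℕ) := by
  rw [← tsum_pow_div_one_sub_eq_tsum_sigma hq ν,
    tsum_pnat_eq_tsum_succ (f := fun n : ℕ ↦ (n : ℂ) ^ ν * q ^ n / (1 - q ^ n))]
  simp [Phi]

lemma E_eq_Phi {k : ℕ} (hk : 3 ≤ k) (hk2 : Even k) (z : ℍ) :
    E hk z = 1 - (2 * k / bernoulli k) * Phi (k - 1) (cexp (2 * π * Complex.I * z)) := by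
  rw [q_expansion_bernoulli hk hk2, Phi_eq_sigma _ (norm_exp_two_pi_I_lt_one z)]
  simp

/-- With Q = 1 + 240Φ₃ and R = 1 − 504Φ₅,
Φ₁₅ = (−3617 + 1617Q⁴ + 2000QR²)/16320 for |q| < 1. -/
theorem Phi15_eval (q : ℂ) (hq : ‖q‖ < 1) :
    Phi 15 q = (-3617 + 1617 * (1 + 240 * Phi 3 q) ^ 4
        + 2000 * (1 + 240 * Phi 3 q) * (1 - 504 * Phi 5 q) ^ 2) / 16320 := by
  rcases eq_or_ne q 0 with rfl | hq0
  · norm_num [Phi]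
  · obtain ⟨z, rfl⟩ : ∃ z : ℍ, cexp (2 * π * Complex.I * z) = q := by
      refine ⟨⟨Function.Periodic.invQParam 1 q,
        Function.Periodic.im_invQParam_pos_of_norm_lt_one one_pos hq hq0⟩, ?_⟩
      have := Function.Periodic.qParam_right_inv (h := 1) one_ne_zero hq0
      simpa [Function.Periodic.qParam] using this
    have h := weight16Form_apply z
    rw [weight16Form_eq_zero] at h
    have h4 := E_eq_Phi (by norm_num : 3 ≤ 4) ⟨2, rfl⟩ z
    have h6 := E_eq_Phi (by norm_num : 3 ≤ 6) ⟨3, rfl⟩ z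
    have h16 := E_eq_Phi (by norm_num : 3 ≤ 16) ⟨8, rfl⟩ z
    rw [bernoulli_four_val] at h4
    rw [bernoulli_six_val] at h6
    rw [bernoulli_sixteen_val] at h16
    norm_num at h4 h6 h16
    rw [h4, h6, h16] at h
    simp only [ModularForm.zero_apply] at h
    linear_combination (-1 / 16320 : ℂ) * h
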